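/- arXiv:0808.3790 — 9 statements merged into one kernel-verified Lean document; each statement's English description precedes it below -/
import Mathlib

section
/- Let σ : ℝ → ℝ be a continuously differentiable Markov strategy converging to k̄, with flow K and with σ(K(t,k)) > 0 for all t,k. Let R(·,k) solve dR/dt(t,k) = (f'(K(t,k)) − σ'(K(t,k))) R(t,k), R(0,k) = 1, and assume R(t,k) = ∂K/∂k(t,k). Define v(k) := ∫₀^∞ h(t) u(σ(K(t,k))) dt, assume this integral converges for every k, that v is differentiable, and that differentiation under the integral sign is valid: v'(k) = ∫₀^∞ h(t) u'(σ(K(t,k))) σ'(K(t,k)) R(t,k) dt. Define the deviation payoff P₁(k,σ,c) := u(c) − u(σ(k)) + ∫₀^∞ h(t) u'(σ(K(t,k))) σ'(K(t,k)) R(t,k) (σ(k) − c) dt. If for every k the function c ↦ P₁(k,σ,c) attains its maximum over c > 0 at c = σ(k), then u'(σ(k)) = v'(k) for all k, i.e. σ(k) = i(v'(k)), and consequently v satisfies the integrated equation v(k) = ∫₀^∞ h(t) u(i(v'(K(t,k)))) dt for all k. -/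
open MeasureTheory Filter Set

/-- Necessary condition for an equilibrium strategy: if the deviation payoff
`P₁(k,σ,·)` is maximized over `c > 0` at `c = σ(k)` for every `k`, then
`u'(σ(k)) = v'(k)` (so `σ = i ∘ v'`) and the value function `v` satisfies the
integrated equation `v(k) = ∫₀^∞ h(t) u(i(v'(K(t,k)))) dt`. -/
theorem stmt_0
    (f σ u i h v : ℝ → ℝ) (K R : ℝ → ℝ → ℝ) (kbar : ℝ) (P1 : ℝ → ℝ → ℝ)
    -- production function
    (hf_mono : StrictMono f)
    (hf_concave : ConcaveOn ℝ Set.univ f)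
    (hf_smooth : ContDiff ℝ 1 f)
    -- Markov strategy and its flow
    (hσ_smooth : ContDiff ℝ 1 σ)
    (hK0 : ∀ k : ℝ, K 0 k = k)
    (hKflow : ∀ k : ℝ, ∀ t ≥ (0 : ℝ),
      HasDerivAt (fun s => K s k) (f (K t k) - σ (K t k)) t)
    -- σ converges to k̄
    (hconv : ∀ᶠ k in nhds kbar, Tendsto (fun t => K t k) atTop (nhds kbar))
    -- positivity of consumption along the flow
    (hσpos : ∀ k : ℝ, ∀ t ≥ (0 : ℝ), 0 < σ (K t k))
    -- R solves the linearized equation and equals ∂K/∂k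
    (hR0 : ∀ k : ℝ, R 0 k = 1)
    (hRflow : ∀ k : ℝ, ∀ t ≥ (0 : ℝ),
      HasDerivAt (fun s => R s k) ((deriv f (K t k) - deriv σ (K t k)) * R t k) t)
    (hRK : ∀ k : ℝ, ∀ t ≥ (0 : ℝ), HasDerivAt (fun x => K t x) (R t k) k)
    -- utility and inverse marginal utility
    (hu_mono : StrictMonoOn u (Set.Ioi 0))
    (hu_smooth : ContDiffOn ℝ 2 u (Set.Ioi 0))
    (hu_concave : StrictConcaveOn ℝ (Set.Ioi 0) u)
    (hi : ∀ c ∈ Set.Ioi (0 : ℝ), i (deriv u c) = c)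
    -- discount function
    (hh_smooth : ContDiffOn ℝ 1 h (Set.Ici 0))
    (hh_pos : ∀ t ≥ (0 : ℝ), 0 < h t)
    (hh0 : h 0 = 1)
    (hh_int : IntegrableOn h (Set.Ioi 0))
    -- the value function, convergence of the integral, and differentiation under
    -- the integral sign
    (hv_def : ∀ k : ℝ, v k = ∫ t in Set.Ioi (0 : ℝ), h t * u (σ (K t k)))
    (hv_int : ∀ k : ℝ, IntegrableOn (fun t => h t * u (σ (K t k))) (Set.Ioi 0))
    (hv_deriv : ∀ k : ℝ, HasDerivAt v
      (∫ t in Set.Ioi (0 : ℝ), h t * deriv u (σ (K t k)) * deriv σ (K t k) * R t k) k)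
    -- the deviation payoff
    (hP1 : ∀ k c : ℝ, P1 k c = u c - u (σ k)
      + ∫ t in Set.Ioi (0 : ℝ),
          h t * deriv u (σ (K t k)) * deriv σ (K t k) * R t k * (σ k - c))
    -- equilibrium condition: the maximum over c > 0 is attained at c = σ(k)
    (hmax : ∀ k : ℝ, ∀ c > (0 : ℝ), P1 k c ≤ P1 k (σ k)) :
    ∀ k : ℝ, deriv u (σ k) = deriv v k ∧ σ k = i (deriv v k) ∧
      v k = ∫ t in Set.Ioi (0 : ℝ), h t * u (i (deriv v (K t k))) := by
  have hpos : ∀ k : ℝ, 0 < σ k := fun k => by simpa [hK0] using hσpos k 0 le_rfl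
  have hfoc : ∀ k : ℝ, deriv u (σ k) = deriv v k := by
    intro k
    have hP : ∀ c : ℝ, P1 k c = u c - u (σ k) + deriv v k * (σ k - c) := fun c => by
      rw [hP1, integral_mul_const, (hv_deriv k).deriv]
    have hu : DifferentiableAt ℝ u (σ k) :=
      (hu_smooth.contDiffAt (Ioi_mem_nhds (hpos k))).differentiableAt (by norm_num)
    have hderiv : HasDerivAt (P1 k) (deriv u (σ k) - deriv v k) (σ k) := by
      rw [funext hP]
      exact ((hu.hasDerivAt.sub_const (u (σ k))).add
        (((hasDerivAt_id (σ k)).const_sub (σ k)).const_mul (deriv v k))).congr_deriv (by ring)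
    have hlocal : IsLocalMax (P1 k) (σ k) := by
      filter_upwards [Ioi_mem_nhds (hpos k)] with c hc using hmax k c hc
    exact sub_eq_zero.mp (hlocal.hasDerivAt_eq_zero hderiv)
  have hinv : ∀ k : ℝ, i (deriv v k) = σ k := fun k => by
    rw [← hfoc k, hi _ (hpos k)]
  intro k
  refine ⟨hfoc k, (hinv k).symm, ?_⟩
  simp only [hinv]
  exact hv_def k
end

section
/- Let v : ℝ → ℝ be twice continuously differentiable with v'(k) in the range of u' for every k, and set σ := i ∘ v'. Assume σ converges to k̄ with flow K, let R(·,k) solve dR/dt(t,k) = (f'(K(t,k)) − σ'(K(t,k))) R(t,k), R(0,k) = 1, and assume that for every k the identity v'(k) = ∫₀^∞ h(t) u'(σ(K(t,k))) σ'(K(t,k)) R(t,k) dt holds (all integrals being convergent). Define P₁(k,σ,c) := u(c) − u(σ(k)) + ∫₀^∞ h(t) u'(σ(K(t,k))) σ'(K(t,k)) R(t,k) (σ(k) − c) dt. Then for every k and every c > 0 one has P₁(k,σ,c) = u(c) − u(σ(k)) − u'(σ(k))(c − σ(k)) ≤ 0 = P₁(k,σ,σ(k)); hence c = σ(k) maximizes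 c ↦ P₁(k,σ,c), i.e. σ is an equilibrium strategy. -/
open MeasureTheory Filter Set

/-- A concave function lies below its tangent lines. -/
lemma ConcaveOn.le_tangent_of_hasDerivAt {S : Set ℝ} {g : ℝ → ℝ} {x y m : ℝ}
    (hg : ConcaveOn ℝ S g) (hx : x ∈ S) (hy : y ∈ S) (hm : HasDerivAt g m x) :
    g y ≤ g x + m * (y - x) := by
  rcases lt_trichotomy x y with hxy | rfl | hxy
  · have hslope := hg.slope_le_of_hasDerivAt hx hy hxy hm
    rw [slope_def_field, div_le_iff₀ (sub_pos.2 hxy)] at hslope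
    linarith
  · simp
  · have hslope := hg.le_slope_of_hasDerivAt hy hx hxy hm
    rw [slope_def_field, le_div_iff₀ (sub_pos.2 hxy)] at hslope
    linarith

/-- Sufficient condition for an equilibrium strategy: if `v` is C² with `v'` in the
range of `u'`, `σ = i ∘ v'` is convergent, and the envelope identity
`v'(k) = ∫₀^∞ h(t) u'(σ(K(t,k))) σ'(K(t,k)) R(t,k) dt` holds, then for every `k`
and `c > 0`, `P₁(k,σ,c) = u(c) − u(σ(k)) − u'(σ(k))(c − σ(k)) ≤ 0 = P₁(k,σ,σ(k))`;
hence `c = σ(k)` maximizes `P₁(k,σ,·)`, i.e. `σ` is an equilibrium strategy. -/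
theorem stmt_1
    (f σ u i h v : ℝ → ℝ) (K R : ℝ → ℝ → ℝ) (kbar : ℝ) (P1 : ℝ → ℝ → ℝ)
    -- production function
    (hf_mono : StrictMono f)
    (hf_concave : ConcaveOn ℝ Set.univ f)
    (hf_smooth : ContDiff ℝ 1 f)
    -- the value function and the strategy σ = i ∘ v'
    (hv_smooth : ContDiff ℝ 2 v)
    (hrange : ∀ k : ℝ, deriv v k ∈ deriv u '' Set.Ioi 0)
    (hσ : ∀ k : ℝ, σ k = i (deriv v k))
    (hσ_smooth : ContDiff ℝ 1 σ)
    -- flow of the strategy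
    (hK0 : ∀ k : ℝ, K 0 k = k)
    (hKflow : ∀ k : ℝ, ∀ t ≥ (0 : ℝ),
      HasDerivAt (fun s => K s k) (f (K t k) - σ (K t k)) t)
    -- σ converges to k̄
    (hconv : ∀ᶠ k in nhds kbar, Tendsto (fun t => K t k) atTop (nhds kbar))
    (hσpos : ∀ k : ℝ, ∀ t ≥ (0 : ℝ), 0 < σ (K t k))
    -- R solves the linearized equation
    (hR0 : ∀ k : ℝ, R 0 k = 1)
    (hRflow : ∀ k : ℝ, ∀ t ≥ (0 : ℝ),
      HasDerivAt (fun s => R s k) ((deriv f (K t k) - deriv σ (K t k)) * R t k) t)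
    -- utility and inverse marginal utility
    (hu_mono : StrictMonoOn u (Set.Ioi 0))
    (hu_smooth : ContDiffOn ℝ 2 u (Set.Ioi 0))
    (hu_concave : StrictConcaveOn ℝ (Set.Ioi 0) u)
    (hi : ∀ c ∈ Set.Ioi (0 : ℝ), i (deriv u c) = c)
    -- discount function
    (hh_smooth : ContDiffOn ℝ 1 h (Set.Ici 0))
    (hh_pos : ∀ t ≥ (0 : ℝ), 0 < h t)
    (hh0 : h 0 = 1)
    (hh_int : IntegrableOn h (Set.Ioi 0))
    -- the integrals are convergent
    (hint : ∀ k : ℝ, IntegrableOn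
      (fun t => h t * deriv u (σ (K t k)) * deriv σ (K t k) * R t k) (Set.Ioi 0))
    -- envelope identity (differentiation under the integral sign)
    (henv : ∀ k : ℝ, deriv v k
      = ∫ t in Set.Ioi (0 : ℝ), h t * deriv u (σ (K t k)) * deriv σ (K t k) * R t k)
    -- the deviation payoff
    (hP1 : ∀ k c : ℝ, P1 k c = u c - u (σ k)
      + ∫ t in Set.Ioi (0 : ℝ),
          h t * deriv u (σ (K t k)) * deriv σ (K t k) * R t k * (σ k - c)) :
    ∀ k : ℝ, ∀ c > (0 : ℝ),
      P1 k c = u c - u (σ k) - deriv u (σ k) * (c - σ k) ∧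
      P1 k c ≤ 0 ∧ P1 k (σ k) = 0 ∧ P1 k c ≤ P1 k (σ k) := by
  intro k c hc
  obtain ⟨a, ha, hav⟩ := hrange k
  have hσa : σ k = a := by rw [hσ k, ← hav, hi a ha]
  have hpayoff (c : ℝ) : P1 k c = u c - u (σ k) - deriv u (σ k) * (c - σ k) := by
    rw [hP1, integral_mul_const, ← henv, ← hav, hσa]
    ring
  have hderiv : HasDerivAt u (deriv u (σ k)) (σ k) := by
    rw [hσa]
    exact ((hu_smooth.differentiableOn two_ne_zero).differentiableAt
      (Ioi_mem_nhds ha)).hasDerivAt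
  have htangent := hu_concave.concaveOn.le_tangent_of_hasDerivAt (hσa ▸ ha) hc hderiv
  have hzero : P1 k (σ k) = 0 := by rw [hpayoff]; ring
  have hnonpos : P1 k c ≤ 0 := by rw [hpayoff]; linarith
  exact ⟨hpayoff c, hnonpos, hzero, hzero ▸ hnonpos⟩
end

section
/- Neither X₁ nor X₂ is differentiable at μ = 0 from the right: as μ → 0⁺ one has X₂(μ)/μ → +∞ and X₁(μ)/μ → −∞. -/
open Filter Topology

/-- A solution of `x - log (1 + x) = μ` is at least of order `√μ` in absolute value. -/
theorem sqrt_div_two_le_abs_of_sub_log_eq {x μ : ℝ} (hx : -1 < x) (hμ : 0 < μ) (hμ1 : μ ≤ 1)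
    (h : x - Real.log (1 + x) = μ) : √μ / 2 ≤ |x| := by
  have hx1 : 0 < 1 + x := by linarith
  have hlog : 1 - (1 + x)⁻¹ ≤ Real.log (1 + x) := Real.one_sub_inv_le_log_of_pos hx1
  have hle : μ * (1 + x) ≤ x ^ 2 := by
    have hinv : (1 + x)⁻¹ * (1 + x) = 1 := inv_mul_cancel₀ hx1.ne'
    nlinarith [mul_le_mul_of_nonneg_right hlog hx1.le]
  have hs : √μ ^ 2 = μ := Real.sq_sqrt hμ.le
  have hs0 : 0 < √μ := Real.sqrt_pos.2 hμ
  have hs1 : √μ ≤ 1 := Real.sqrt_le_one.2 hμ1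
  by_contra! hlt
  have hsq : x ^ 2 ≤ μ / 4 := by
    rw [← sq_abs]
    nlinarith [abs_nonneg x]
  have hneg : -(1 / 2) ≤ x := by linarith [neg_abs_le x]
  nlinarith

theorem tendsto_inv_sqrt_div_two_nhdsGT_zero :
    Tendsto (fun μ : ℝ => (√μ)⁻¹ / 2) (𝓝[>] 0) atTop := by
  refine Tendsto.atTop_div_const two_pos (tendsto_inv_nhdsGT_zero.comp ?_)
  refine tendsto_nhdsWithin_iff.2 ⟨?_, ?_⟩
  · simpa using (Real.continuous_sqrt.tendsto 0).mono_left nhdsWithin_le_nhds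
  · filter_upwards [self_mem_nhdsWithin] with μ hμ using Real.sqrt_pos.2 hμ

theorem tendsto_abs_div_atTop_of_sub_log_eq {X : ℝ → ℝ}
    (hX : ∀ μ > (0 : ℝ), -1 < X μ ∧ X μ - Real.log (1 + X μ) = μ) :
    Tendsto (fun μ => |X μ| / μ) (𝓝[>] 0) atTop := by
  refine tendsto_atTop_mono' _ ?_ tendsto_inv_sqrt_div_two_nhdsGT_zero
  filter_upwards [Ioc_mem_nhdsGT (zero_lt_one' ℝ)] with μ hμ
  have hle := sqrt_div_two_le_abs_of_sub_log_eq (hX μ hμ.1).1 hμ.1 hμ.2 (hX μ hμ.1).2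
  have hs0 : 0 < √μ := Real.sqrt_pos.2 hμ.1
  have heq : (√μ)⁻¹ / 2 * μ = √μ / 2 := by
    nth_rewrite 2 [← Real.mul_self_sqrt hμ.1.le]
    field_simp
  rwa [le_div_iff₀ hμ.1, heq]

theorem HasDerivWithinAt.tendsto_div_nhdsGT_zero {X : ℝ → ℝ} {d : ℝ} (h0 : X 0 = 0)
    (h : HasDerivWithinAt X d (Set.Ici 0) 0) :
    Tendsto (fun μ => X μ / μ) (𝓝[>] 0) (𝓝 d) := by
  rw [hasDerivWithinAt_iff_tendsto_slope, Set.Ici_sdiff_left] at h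
  refine h.congr fun μ => ?_
  simp [slope_def_field, h0]


/-- Neither branch `X₁`, `X₂` of solutions of `x - ln(1+x) = μ` is differentiable
at `μ = 0` from the right: the difference quotients `X₂(μ)/μ` and `X₁(μ)/μ`
tend to `+∞` and `-∞` respectively as `μ → 0⁺`. -/
theorem stmt_10 (X₁ X₂ : ℝ → ℝ)
    (hX₁ : ∀ μ > (0 : ℝ), X₁ μ ∈ Set.Ioo (-1 : ℝ) 0 ∧ X₁ μ - Real.log (1 + X₁ μ) = μ)
    (hX₂ : ∀ μ > (0 : ℝ), 0 < X₂ μ ∧ X₂ μ - Real.log (1 + X₂ μ) = μ)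
    (hX₁0 : X₁ 0 = 0) (hX₂0 : X₂ 0 = 0) :
    Filter.Tendsto (fun μ => X₂ μ / μ) (nhdsWithin 0 (Set.Ioi 0)) Filter.atTop ∧
    Filter.Tendsto (fun μ => X₁ μ / μ) (nhdsWithin 0 (Set.Ioi 0)) Filter.atBot ∧
    (∀ d : ℝ, ¬ HasDerivWithinAt X₂ d (Set.Ici 0) 0) ∧
    (∀ d : ℝ, ¬ HasDerivWithinAt X₁ d (Set.Ici 0) 0) := by
  have h₂ : Tendsto (fun μ => X₂ μ / μ) (𝓝[>] 0) atTop := by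
    refine (tendsto_abs_div_atTop_of_sub_log_eq (X := X₂) fun μ hμ =>
      ⟨by linarith [(hX₂ μ hμ).1], (hX₂ μ hμ).2⟩).congr' ?_
    filter_upwards [self_mem_nhdsWithin] with μ hμ
    rw [abs_of_pos (hX₂ μ hμ).1]
  have h₁ : Tendsto (fun μ => X₁ μ / μ) (𝓝[>] 0) atBot := by
    rw [← tendsto_neg_atTop_iff]
    refine (tendsto_abs_div_atTop_of_sub_log_eq (X := X₁) fun μ hμ =>
      ⟨(hX₁ μ hμ).1.1, (hX₁ μ hμ).2⟩).congr' ?_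
    filter_upwards [self_mem_nhdsWithin] with μ hμ
    rw [abs_of_neg (hX₁ μ hμ).1.2, neg_div]
  exact ⟨h₂, h₁,
    fun d hd => not_tendsto_nhds_of_tendsto_atTop h₂ d (hd.tendsto_div_nhdsGT_zero hX₂0),
    fun d hd => not_tendsto_nhds_of_tendsto_atBot h₁ d (hd.tendsto_div_nhdsGT_zero hX₁0)⟩
end

section
/- Let 0 < ρ < δ and π > 0, let f : ℝ → ℝ be differentiable, and let v, w : Ω → ℝ be defined on an open interval Ω containing k̄, with v twice differentiable, w continuously differentiable, v' > 0 on Ω, satisfying on Ω the system (f(k) − 1/v'(k)) v'(k) − ln(v'(k)) = δ v(k) − (δ−ρ) w(k) and (f(k) − 1/v'(k)) w'(k) = −π v(k) + (ρ+π) w(k). Assume f(k̄) > 0, f(k̄) v'(k̄) = 1 and f'(k̄) ≠ δ. Then f'(k̄) + v''(k̄)/v'(k̄)² = (ρ(δ+π) − (ρ+π) f'(k̄)) / (δ − f'(k̄)). -/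
/-- The product rule at a zero of the first factor needs only continuity of the second. -/
theorem HasDerivAt.mul_continuousAt_of_eq_zero {g h : ℝ → ℝ} {x g' : ℝ}
    (hg : HasDerivAt g g' x) (hh : ContinuousAt h x) (hx : g x = 0) :
    HasDerivAt (fun y => g y * h y) (g' * h x) x := by
  rw [hasDerivAt_iff_tendsto_slope] at hg ⊢
  refine (hg.mul (hh.tendsto.mono_left nhdsWithin_le_nhds)).congr fun y => ?_
  simp only [slope_def_field, hx]
  ring

/-- At a steady state `k̄` (`f(k̄)v'(k̄) = 1`) of the coupled system
`(f − 1/v')v' − ln v' = δv − (δ−ρ)w`, `(f − 1/v')w' = −πv + (ρ+π)w`, the linearization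
coefficient of the capital dynamics satisfies
`f'(k̄) + v''(k̄)/v'(k̄)² = (ρ(δ+π) − (ρ+π)f'(k̄))/(δ − f'(k̄))`. -/
theorem stmt_11 (ρ δ π : ℝ) (hρ : 0 < ρ) (hρδ : ρ < δ) (hπ : 0 < π)
    (f v w : ℝ → ℝ) (a b kbar : ℝ) (hk : kbar ∈ Set.Ioo a b)
    (hf : Differentiable ℝ f)
    (hv1 : ∀ k ∈ Set.Ioo a b, DifferentiableAt ℝ v k)
    (hv2 : ∀ k ∈ Set.Ioo a b, DifferentiableAt ℝ (deriv v) k)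
    (hw1 : ∀ k ∈ Set.Ioo a b, DifferentiableAt ℝ w k)
    (hw2 : ContinuousOn (deriv w) (Set.Ioo a b))
    (hv'pos : ∀ k ∈ Set.Ioo a b, 0 < deriv v k)
    (heq1 : ∀ k ∈ Set.Ioo a b,
      (f k - 1 / deriv v k) * deriv v k - Real.log (deriv v k) = δ * v k - (δ - ρ) * w k)
    (heq2 : ∀ k ∈ Set.Ioo a b,
      (f k - 1 / deriv v k) * deriv w k = -π * v k + (ρ + π) * w k)
    (hfk : 0 < f kbar)
    (hsteady : f kbar * deriv v kbar = 1)
    (hne : deriv f kbar ≠ δ) :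
    deriv f kbar + deriv (deriv v) kbar / (deriv v kbar) ^ 2
      = (ρ * (δ + π) - (ρ + π) * deriv f kbar) / (δ - deriv f kbar) := by
  have hnhds : Set.Ioo a b ∈ nhds kbar := isOpen_Ioo.mem_nhds hk
  have hp : 0 < deriv v kbar := hv'pos kbar hk
  have df := (hf kbar).hasDerivAt
  have dv := (hv1 kbar hk).hasDerivAt
  have dw := (hw1 kbar hk).hasDerivAt
  have dv' := (hv2 kbar hk).hasDerivAt
  have dg : HasDerivAt (fun k => f k - 1 / deriv v k)
      (deriv f kbar + deriv (deriv v) kbar / deriv v kbar ^ 2) kbar := by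
    simpa only [one_div, neg_div, sub_neg_eq_add] using df.fun_sub (dv'.fun_inv hp.ne')
  have hg0 : f kbar - 1 / deriv v kbar = 0 := by
    rw [eq_div_of_mul_eq hp.ne' hsteady, sub_self]
  have h1 := ((dg.mul dv').sub (dv'.log hp.ne')).unique
    (((dv.const_mul δ).sub (dw.const_mul (δ - ρ))).congr_of_eventuallyEq
      (Filter.eventually_of_mem hnhds heq1))
  have h2 := (dg.mul_continuousAt_of_eq_zero (hw2.continuousAt hnhds) hg0).unique
    (((dv.const_mul (-π)).add (dw.const_mul (ρ + π))).congr_of_eventuallyEq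
      (Filter.eventually_of_mem hnhds heq2))
  have h1' : deriv f kbar * deriv v kbar = δ * deriv v kbar - (δ - ρ) * deriv w kbar := by
    rw [← h1, hg0]
    field_simp
    ring
  rw [eq_div_iff (sub_ne_zero.mpr hne.symm)]
  refine mul_right_cancel₀ hp.ne' ?_
  linear_combination (δ - ρ) * h2 +
    (ρ + π - (deriv f kbar + deriv (deriv v) kbar / deriv v kbar ^ 2)) * h1'
end

section
/- Let 0 < ρ < δ and π > 0, let f : ℝ → ℝ be differentiable, and let v, w : Ω → ℝ be defined on an open interval Ω containing k̄, with v twice differentiable, w continuously differentiable, v' > 0 on Ω, satisfying on Ω the system (f(k) − 1/v'(k)) v'(k) − ln(v'(k)) = δ v(k) − (δ−ρ) w(k) and (f(k) − 1/v'(k)) w'(k) = −π v(k) + (ρ+π) w(k). Assume f(k̄) > 0, f(k̄) v'(k̄) = 1 and f'(k̄) ≠ δ. Then f'(k̄) + v''(k̄)/v'(k̄)² < 0 if and only if ρ(δ+π)/(π+ρ) < f'(k̄) < δ; that is, the linearization at k̄ of the capital dynamics dk/dt = f(k) − 1/v'(k) is attracting exactly when f'(k̄) lies in the open interval (ρ(δ+π)/(π+ρ),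 δ). -/
/-- A product `F * g` is differentiable at a zero of `F` where `F` is differentiable and `g` is
merely continuous. -/
theorem HasDerivAt.mul_continuousAt_of_eq_zero_s12 {F g : ℝ → ℝ} {x F' : ℝ}
    (hF : HasDerivAt F F' x) (hg : ContinuousAt g x) (h0 : F x = 0) :
    HasDerivAt (fun k => F k * g k) (F' * g x) x := by
  rw [hasDerivAt_iff_tendsto_slope] at hF ⊢
  refine (hF.mul (hg.tendsto.mono_left nhdsWithin_le_nhds)).congr fun y => ?_
  simp only [slope_def_field, h0]
  ring

/-- Elimination of `q` from the two differentiated equations at a steady state. -/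
theorem rate_neg_iff_of_linearized {ρ δ π m l p q : ℝ} (hρ : 0 < ρ) (hρδ : ρ < δ) (hπ : 0 < π)
    (hp : 0 < p) (h1 : m * p = δ * p - (δ - ρ) * q) (h2 : l * q = -π * p + (ρ + π) * q)
    (hne : m ≠ δ) : l < 0 ↔ ρ * (δ + π) / (π + ρ) < m ∧ m < δ := by
  have key : l * (δ - m) = (ρ + π) * (δ - m) - π * (δ - ρ) :=
    mul_right_cancel₀ hp.ne' (by linear_combination (δ - ρ) * h2 + (ρ + π - l) * h1)
  rw [div_lt_iff₀ (by positivity)]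
  rcases lt_or_gt_of_ne hne with h | h
  · have hpos : 0 < δ - m := sub_pos.2 h
    have hiff : l < 0 ↔ l * (δ - m) < 0 :=
      ⟨fun hl => mul_neg_of_neg_of_pos hl hpos, fun hl => neg_of_mul_neg_left hl hpos.le⟩
    rw [hiff, key]
    constructor
    · intro _
      exact ⟨by linarith, h⟩
    · rintro ⟨_, -⟩
      linarith
  · have : 0 < π * (δ - ρ) := mul_pos hπ (sub_pos.2 hρδ)
    have : 0 < (ρ + π) * (m - δ) := mul_pos (by positivity) (sub_pos.2 h)
    constructor
    · intro hl
      nlinarith [mul_pos_of_neg_of_neg hl (sub_neg.2 h)]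
    · rintro ⟨-, _⟩
      linarith


/-- At a steady state `k̄` (`f(k̄)v'(k̄) = 1`) of the coupled system
`(f − 1/v')v' − ln v' = δv − (δ−ρ)w`, `(f − 1/v')w' = −πv + (ρ+π)w`, the linearization
of the capital dynamics `dk/dt = f(k) − 1/v'(k)` at `k̄` is attracting, i.e.
`f'(k̄) + v''(k̄)/v'(k̄)² < 0`, exactly when `ρ(δ+π)/(π+ρ) < f'(k̄) < δ`. -/
theorem stmt_12 (ρ δ π : ℝ) (hρ : 0 < ρ) (hρδ : ρ < δ) (hπ : 0 < π)
    (f v w : ℝ → ℝ) (a b kbar : ℝ) (hk : kbar ∈ Set.Ioo a b)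
    (hf : Differentiable ℝ f)
    (hv1 : ∀ k ∈ Set.Ioo a b, DifferentiableAt ℝ v k)
    (hv2 : ∀ k ∈ Set.Ioo a b, DifferentiableAt ℝ (deriv v) k)
    (hw1 : ∀ k ∈ Set.Ioo a b, DifferentiableAt ℝ w k)
    (hw2 : ContinuousOn (deriv w) (Set.Ioo a b))
    (hv'pos : ∀ k ∈ Set.Ioo a b, 0 < deriv v k)
    (heq1 : ∀ k ∈ Set.Ioo a b,
      (f k - 1 / deriv v k) * deriv v k - Real.log (deriv v k) = δ * v k - (δ - ρ) * w k)
    (heq2 : ∀ k ∈ Set.Ioo a b,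
      (f k - 1 / deriv v k) * deriv w k = -π * v k + (ρ + π) * w k)
    (hfk : 0 < f kbar)
    (hsteady : f kbar * deriv v kbar = 1)
    (hne : deriv f kbar ≠ δ) :
    (deriv f kbar + deriv (deriv v) kbar / (deriv v kbar) ^ 2 < 0 ↔
      ρ * (δ + π) / (π + ρ) < deriv f kbar ∧ deriv f kbar < δ) := by
  have hp := hv'pos kbar hk
  have hnhds : Set.Ioo a b ∈ nhds kbar := Ioo_mem_nhds hk.1 hk.2
  have hdf := (hf kbar).hasDerivAt
  have hdv := (hv1 kbar hk).hasDerivAt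
  have hdv' := (hv2 kbar hk).hasDerivAt
  have hdw := (hw1 kbar hk).hasDerivAt
  have hF : HasDerivAt (fun k => f k - 1 / deriv v k)
      (deriv f kbar + deriv (deriv v) kbar / (deriv v kbar) ^ 2) kbar := by
    refine (hdf.sub ((hasDerivAt_const kbar (1 : ℝ)).div hdv' hp.ne')).congr_deriv ?_
    ring
  have hF0 : f kbar - 1 / deriv v kbar = 0 := by
    rw [← hsteady]
    field_simp
    ring
  have hl1 := (hF.mul hdv').sub (hdv'.log hp.ne')
  have hr1 := (hdv.const_mul δ).sub (hdw.const_mul (δ - ρ))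
  have h1 := hl1.unique (hr1.congr_of_eventuallyEq (Filter.eventually_of_mem hnhds heq1))
  have hl2 := hF.mul_continuousAt_of_eq_zero_s12 (hw2.continuousAt hnhds) hF0
  have hr2 := (hdv.const_mul (-π)).add (hdw.const_mul (ρ + π))
  have h2 := hl2.unique (hr2.congr_of_eventuallyEq (Filter.eventually_of_mem hnhds heq2))
  refine rate_neg_iff_of_linearized hρ hρδ hπ hp ?_ h2 hne
  rw [← h1, hF0]
  field_simp
  ring
end

section
/- Let 0 < ρ < δ, let f : ℝ → ℝ be differentiable with f(k̄) > 0, and let v, w : Ω → ℝ be defined on an open interval Ω containing k̄, with v twice differentiable and w differentiable at k̄, satisfying on Ω the equation (f(k) − 1/v'(k)) v'(k) − ln(v'(k)) = δ v(k) − (δ−ρ) w(k), with v' > 0 on Ω and f(k̄) v'(k̄) = 1. Then w'(k̄) = (δ − f'(k̄)) / ((δ−ρ) f(k̄)). -/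
/-- Differentiating the first value equation `(f − 1/v')v' − ln v' = δv − (δ−ρ)w` at a
steady state `k̄` with `f(k̄)v'(k̄) = 1` yields `w'(k̄) = (δ − f'(k̄))/((δ−ρ)f(k̄))`. -/
theorem stmt_13 (ρ δ : ℝ) (hρ : 0 < ρ) (hρδ : ρ < δ)
    (f v w : ℝ → ℝ) (a b kbar : ℝ) (hk : kbar ∈ Set.Ioo a b)
    (hf : Differentiable ℝ f) (hfk : 0 < f kbar)
    (hv1 : ∀ k ∈ Set.Ioo a b, DifferentiableAt ℝ v k)
    (hv2 : ∀ k ∈ Set.Ioo a b, DifferentiableAt ℝ (deriv v) k)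
    (hwk : DifferentiableAt ℝ w kbar)
    (hv'pos : ∀ k ∈ Set.Ioo a b, 0 < deriv v k)
    (heq1 : ∀ k ∈ Set.Ioo a b,
      (f k - 1 / deriv v k) * deriv v k - Real.log (deriv v k) = δ * v k - (δ - ρ) * w k)
    (hsteady : f kbar * deriv v kbar = 1) :
    deriv w kbar = (δ - deriv f kbar) / ((δ - ρ) * f kbar) := by
  have hp := hv'pos kbar hk
  have hL : HasDerivAt (fun k => f k * deriv v k - 1 - Real.log (deriv v k))
      (deriv f kbar * deriv v kbar + f kbar * deriv (deriv v) kbar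
        - deriv (deriv v) kbar / deriv v kbar) kbar :=
    (((hf kbar).hasDerivAt.mul (hv2 kbar hk).hasDerivAt).sub_const 1).sub
      ((hv2 kbar hk).hasDerivAt.log hp.ne')
  have hR : HasDerivAt (fun k => δ * v k - (δ - ρ) * w k)
      (δ * deriv v kbar - (δ - ρ) * deriv w kbar) kbar :=
    ((hv1 kbar hk).hasDerivAt.const_mul δ).sub (hwk.hasDerivAt.const_mul (δ - ρ))
  have hLR : (fun k => f k * deriv v k - 1 - Real.log (deriv v k))
      =ᶠ[nhds kbar] fun k => δ * v k - (δ - ρ) * w k := by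
    filter_upwards [isOpen_Ioo.mem_nhds hk] with k hkI
    rw [← heq1 k hkI, sub_mul, one_div_mul_cancel (hv'pos k hkI).ne']
  have hderiv := hL.unique (hR.congr_of_eventuallyEq hLR)
  have hpf : deriv v kbar = (f kbar)⁻¹ := eq_inv_of_mul_eq_one_right hsteady
  rw [hpf, div_inv_eq_mul] at hderiv
  rw [eq_div_iff (mul_pos (sub_pos.2 hρδ) hfk).ne']
  field_simp at hderiv
  linarith
end

section
/- Let π > 0 and 0 < ρ < δ, and define φ*(s) := (π/δ)((δ+π)/(ρ+π)) ((δ−ρ) e^{−δ s} + ρ) for s ≥ 0. Then: (a) ∫₀^∞ e^{−π s} φ*(s) ds = 1; (b) for every measurable φ : [0,∞) → (0,∞) with ∫₀^∞ e^{−π s} φ(s) ds = 1 and such that s ↦ e^{−(δ+π)s} ln φ(s) and s ↦ e^{−π s} ln φ(s) are integrable, one has J(φ) ≤ J(φ*), where J(φ) := (1/ρ − 1/δ) ∫₀^∞ e^{−(δ+π)s} ln φ(s) ds + (1/δ) ∫₀^∞ e^{−π s} ln φ(s) ds. -/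
open MeasureTheory

/-- A positive measurable function bounded below and above by positive constants has a
logarithm that is integrable against any decaying exponential. -/
lemma integrableOn_exp_mul_log {a l u : ℝ} {f : ℝ → ℝ} (ha : a < 0) (hl : 0 < l)
    (hf : Measurable f) (hlf : ∀ s ∈ Set.Ioi (0 : ℝ), l ≤ f s)
    (hfu : ∀ s ∈ Set.Ioi (0 : ℝ), f s ≤ u) :
    IntegrableOn (fun s => Real.exp (a * s) * Real.log (f s)) (Set.Ioi 0) := by
  refine Integrable.mul_bdd (c := max |Real.log l| |Real.log u|)
    (integrableOn_exp_mul_Ioi ha 0)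
    (Real.measurable_log.comp hf).aestronglyMeasurable ?_
  filter_upwards [ae_restrict_mem measurableSet_Ioi] with s hs
  exact abs_le_max_abs_abs (Real.log_le_log hl (hlf s hs))
    (Real.log_le_log (hl.trans_le (hlf s hs)) (hfu s hs))

/-- The tangent-line form of Gibbs' inequality: `y (log x - log y) ≤ x - y`. -/
lemma mul_log_sub_log_le_sub {x y : ℝ} (hx : 0 < x) (hy : 0 < y) :
    y * (Real.log x - Real.log y) ≤ x - y := by
  rw [← Real.log_div hx.ne' hy.ne']
  calc y * Real.log (x / y) ≤ y * (x / y - 1) :=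
        mul_le_mul_of_nonneg_left (Real.log_le_sub_one_of_pos (div_pos hx hy)) hy.le
    _ = x - y := by field_simp

/-- The rule `φ*(s) = (π/δ)((δ+π)/(ρ+π))((δ−ρ)e^{−δs} + ρ)` satisfies the budget
constraint `∫₀^∞ e^{−πs} φ*(s) ds = 1` and maximizes the intra-period planners'
common objective `J` among all positive measurable rules satisfying the constraint. -/
theorem stmt_16 (π ρ δ : ℝ) (hπ : 0 < π) (hρ : 0 < ρ) (hρδ : ρ < δ) :
    let φstar : ℝ → ℝ := fun s => (π / δ) * ((δ + π) / (ρ + π)) * ((δ - ρ) * Real.exp (-δ * s) + ρ)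
    let J : (ℝ → ℝ) → ℝ := fun φ =>
      (1 / ρ - 1 / δ) * (∫ s in Set.Ioi (0 : ℝ), Real.exp (-(δ + π) * s) * Real.log (φ s)) +
      (1 / δ) * ∫ s in Set.Ioi (0 : ℝ), Real.exp (-π * s) * Real.log (φ s)
    (∫ s in Set.Ioi (0 : ℝ), Real.exp (-π * s) * φstar s) = 1 ∧
    ∀ φ : ℝ → ℝ, Measurable φ → (∀ s ∈ Set.Ioi (0 : ℝ), 0 < φ s) →
      IntegrableOn (fun s => Real.exp (-π * s) * φ s) (Set.Ioi 0) →
      (∫ s in Set.Ioi (0 : ℝ), Real.exp (-π * s) * φ s) = 1 →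
      IntegrableOn (fun s => Real.exp (-(δ + π) * s) * Real.log (φ s)) (Set.Ioi 0) →
      IntegrableOn (fun s => Real.exp (-π * s) * Real.log (φ s)) (Set.Ioi 0) →
      J φ ≤ J φstar := by
  intro φstar J
  have hδ : 0 < δ := hρ.trans hρδ
  have hexp (s : ℝ) : Real.exp (-(δ + π) * s) = Real.exp (-π * s) * Real.exp (-δ * s) := by
    rw [← Real.exp_add]; ring_nf
  have hA : 0 < (π / δ) * ((δ + π) / (ρ + π)) := by positivity
  have h1 : IntegrableOn (fun s => Real.exp (-(δ + π) * s)) (Set.Ioi 0) :=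
    integrableOn_exp_mul_Ioi (by linarith) 0
  have h2 : IntegrableOn (fun s => Real.exp (-π * s)) (Set.Ioi 0) :=
    integrableOn_exp_mul_Ioi (by linarith) 0
  have hsplit : (fun s => Real.exp (-π * s) * φstar s) = fun s =>
      (π / δ) * ((δ + π) / (ρ + π)) *
        ((δ - ρ) * Real.exp (-(δ + π) * s) + ρ * Real.exp (-π * s)) := by
    funext s
    simp only [φstar, hexp]
    ring
  have hint : IntegrableOn (fun s => Real.exp (-π * s) * φstar s) (Set.Ioi 0) := by
    rw [hsplit]
    exact ((h1.const_mul _).add (h2.const_mul _)).const_mul _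
  have hbudget : (∫ s in Set.Ioi (0 : ℝ), Real.exp (-π * s) * φstar s) = 1 := by
    rw [hsplit, integral_const_mul, integral_add (h1.const_mul _) (h2.const_mul _),
      integral_const_mul, integral_const_mul, integral_exp_mul_Ioi (by linarith),
      integral_exp_mul_Ioi (by linarith)]
    simp only [mul_zero, Real.exp_zero, neg_div_neg_eq]
    field_simp
    ring
  refine ⟨hbudget, fun φ _ hpos hφint hφ hlog1 hlog2 => ?_⟩
  have hmeas : Measurable φstar := by fun_prop
  have hlow : ∀ s ∈ Set.Ioi (0 : ℝ), (π / δ) * ((δ + π) / (ρ + π)) * ρ ≤ φstar s := by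
    intro s _
    refine mul_le_mul_of_nonneg_left ?_ hA.le
    nlinarith [Real.exp_pos (-δ * s)]
  have hupp : ∀ s ∈ Set.Ioi (0 : ℝ), φstar s ≤ (π / δ) * ((δ + π) / (ρ + π)) * δ := by
    intro s hs
    refine mul_le_mul_of_nonneg_left ?_ hA.le
    have : Real.exp (-δ * s) ≤ 1 := Real.exp_le_one_iff.2 (by nlinarith [Set.mem_Ioi.1 hs])
    nlinarith
  have hl1 := integrableOn_exp_mul_log (a := -(δ + π)) (by linarith) (mul_pos hA hρ)
    hmeas hlow hupp
  have hl2 := integrableOn_exp_mul_log (a := -π) (by linarith) (mul_pos hA hρ) hmeas hlow hupp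
  have hJ (f : ℝ → ℝ)
      (hf1 : IntegrableOn (fun s => Real.exp (-(δ + π) * s) * Real.log (f s)) (Set.Ioi 0))
      (hf2 : IntegrableOn (fun s => Real.exp (-π * s) * Real.log (f s)) (Set.Ioi 0)) :
      J f = ∫ s in Set.Ioi (0 : ℝ), ((1 / ρ - 1 / δ) *
        (Real.exp (-(δ + π) * s) * Real.log (f s)) +
        (1 / δ) * (Real.exp (-π * s) * Real.log (f s))) := by
    rw [integral_add (hf1.const_mul _) (hf2.const_mul _), integral_const_mul, integral_const_mul]
  have hgap : J φ - J φstar ≤ ∫ s in Set.Ioi (0 : ℝ), (ρ + π) / (ρ * π * (δ + π)) *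
      (Real.exp (-π * s) * φ s - Real.exp (-π * s) * φstar s) := by
    have hi := (hlog1.const_mul (1 / ρ - 1 / δ)).add (hlog2.const_mul (1 / δ))
    have hi' := (hl1.const_mul (1 / ρ - 1 / δ)).add (hl2.const_mul (1 / δ))
    rw [hJ φ hlog1 hlog2, hJ φstar hl1 hl2]
    refine (integral_sub hi hi').symm.trans_le ?_
    refine setIntegral_mono_on (hi.sub hi') ((hφint.sub hint).const_mul _) measurableSet_Ioi ?_
    intro s hs
    have hgibbs := mul_le_mul_of_nonneg_left
      (mul_log_sub_log_le_sub (hpos s hs) ((mul_pos hA hρ).trans_le (hlow s hs)))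
      (show 0 ≤ (ρ + π) / (ρ * π * (δ + π)) * Real.exp (-π * s) by positivity)
    have hweight : (1 / ρ - 1 / δ) * Real.exp (-(δ + π) * s) + (1 / δ) * Real.exp (-π * s) =
        (ρ + π) / (ρ * π * (δ + π)) * Real.exp (-π * s) * φstar s := by
      simp only [φstar, hexp]
      field_simp
    simp only [Pi.add_apply]
    linear_combination hgibbs + (Real.log (φ s) - Real.log (φstar s)) * hweight
  rw [integral_const_mul, integral_sub hφint hint, hφ, hbudget, sub_self, mul_zero] at hgap
  linarith
end

section
/- Let π > 0 and 0 < ρ < δ. Define φ*(n) := (π/δ)((δ+π)/(ρ+π)) ((δ−ρ) e^{−δ n} + ρ), the long-run interest rate r̄ := ρ(π+δ)/(π+ρ), the long-term capital income tax rate η(n) := (1/r̄) ( r̄ − δ − φ*'(n)/φ*(n) ), and the cutoff age ñ := (1/δ) ln((δ+π)/π) (equivalently ñ = −(1/δ) ln(π/(δ+π)) > 0). Then η(n) > 0 for 0 ≤ n < ñ, η(ñ) = 0, and η(n) < 0 for n > ñ; that is, the government taxes the capital income of cohorts younger than ñ and subsidizes that of cohorts older than ñ. -/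
theorem hasDerivAt_affine_exp (c a b δ n : ℝ) :
    HasDerivAt (fun n => c * (a * Real.exp (-δ * n) + b))
      (c * (a * (Real.exp (-δ * n) * -δ))) n := by
  have h : HasDerivAt (fun n : ℝ => -δ * n) (-δ) n := by
    simpa using (hasDerivAt_id n).const_mul (-δ)
  exact ((h.exp.const_mul a).add_const b).const_mul c

/-- The capital income tax rate as a positive multiple of `(δ + π) e^{-δ n} - π`. -/
theorem tax_rate_eq {π ρ δ : ℝ} (hπ : 0 < π) (hρ : 0 < ρ) (hρδ : ρ < δ) (n : ℝ) :
    1 / (ρ * (π + δ) / (π + ρ)) * (ρ * (π + δ) / (π + ρ) - δ -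
      deriv (fun n => (π / δ) * ((δ + π) / (ρ + π)) * ((δ - ρ) * Real.exp (-δ * n) + ρ)) n /
        ((π / δ) * ((δ + π) / (ρ + π)) * ((δ - ρ) * Real.exp (-δ * n) + ρ))) =
      (δ - ρ) / ((π + δ) * ((δ - ρ) * Real.exp (-δ * n) + ρ)) *
        ((δ + π) * Real.exp (-δ * n) - π) := by
  have hδ : 0 < δ := hρ.trans hρδ
  have hD : 0 < (δ - ρ) * Real.exp (-δ * n) + ρ := by
    have := mul_pos (sub_pos.2 hρδ) (Real.exp_pos (-δ * n))
    linarith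
  have hc : π / δ * ((δ + π) / (ρ + π)) ≠ 0 := by positivity
  rw [(hasDerivAt_affine_exp _ _ _ _ _).deriv, mul_div_mul_left _ _ hc]
  generalize Real.exp (-δ * n) = E at hD ⊢
  have hD' := hD.ne'
  have h1 : π + δ ≠ 0 := by positivity
  have h2 : π + ρ ≠ 0 := by positivity
  field_simp
  ring

/-- With the optimal allocation rule `φ*`, long-run interest rate `r̄ = ρ(π+δ)/(π+ρ)`,
long-term capital income tax rate `η(n) = (1/r̄)(r̄ − δ − φ*'(n)/φ*(n))` and cutoff age
`ñ = (1/δ) ln((δ+π)/π) = −(1/δ) ln(π/(δ+π)) > 0`: the tax rate is positive for ages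
below `ñ`, zero at `ñ` and negative for ages above `ñ`. -/
theorem stmt_17 (π ρ δ : ℝ) (hπ : 0 < π) (hρ : 0 < ρ) (hρδ : ρ < δ) :
    let φstar : ℝ → ℝ := fun n => (π / δ) * ((δ + π) / (ρ + π)) * ((δ - ρ) * Real.exp (-δ * n) + ρ)
    let rbar : ℝ := ρ * (π + δ) / (π + ρ)
    let η : ℝ → ℝ := fun n => (1 / rbar) * (rbar - δ - deriv φstar n / φstar n)
    let ntilde : ℝ := (1 / δ) * Real.log ((δ + π) / π)
    (ntilde = -(1 / δ) * Real.log (π / (δ + π)) ∧ 0 < ntilde) ∧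
    (∀ n : ℝ, 0 ≤ n → n < ntilde → 0 < η n) ∧
    η ntilde = 0 ∧
    (∀ n : ℝ, ntilde < n → η n < 0) := by
  have hδ : 0 < δ := hρ.trans hρδ
  have hδπ : 0 < δ + π := by positivity
  intro φstar rbar η ntilde
  have hη (n : ℝ) : η n = (δ - ρ) / ((π + δ) * ((δ - ρ) * Real.exp (-δ * n) + ρ)) *
      ((δ + π) * Real.exp (-δ * n) - π) := tax_rate_eq hπ hρ hρδ n
  have hpos (n : ℝ) : 0 < (δ - ρ) / ((π + δ) * ((δ - ρ) * Real.exp (-δ * n) + ρ)) := by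
    have := sub_pos.2 hρδ
    positivity
  have hlog : ntilde = -(1 / δ) * Real.log (π / (δ + π)) := by
    simp only [ntilde]
    rw [← inv_div π (δ + π), Real.log_inv]
    ring
  have hexp : (δ + π) * Real.exp (-δ * ntilde) = π := by
    have : -δ * ntilde = Real.log (π / (δ + π)) := by
      rw [hlog]
      field_simp
    rw [this, Real.exp_log (by positivity)]
    field_simp
  refine ⟨⟨hlog, mul_pos (by positivity) (Real.log_pos ?_)⟩, fun n _ hn => ?_, ?_, fun n hn => ?_⟩
  · rw [one_lt_div hπ]
    linarith
  · rw [hη]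
    refine mul_pos (hpos n) (sub_pos.2 ?_)
    exact hexp.symm.trans_lt
      (mul_lt_mul_of_pos_left (Real.exp_lt_exp.2 (by nlinarith)) hδπ)
  · rw [hη, hexp, sub_self, mul_zero]
  · rw [hη]
    refine mul_neg_of_pos_of_neg (hpos n) (sub_neg.2 ?_)
    exact (mul_lt_mul_of_pos_left (Real.exp_lt_exp.2 (by nlinarith)) hδπ).trans_eq hexp
end

section
/- Let δ₀ > δ₁ > 0, τ > 0 and A ∈ ℝ, and set m := δ₀ / (1 + ((δ₀ − δ₁)/δ₁) e^{−δ₁ τ}). For k > 0 define g(k) := ∫_τ^∞ e^{−δ₁ t} ln( m k e^{(A − m)t} ) dt, which equals (1/δ₁) e^{−δ₁ τ} ln k + ς for some constant ς independent of k. Then there exists a constant b ∈ ℝ such that v(k) := (1/m) ln k + b satisfies, for every k > 0, the equation δ₀ v(k) = sup_{c > 0} [ ln c + (δ₀ − δ₁) g(k) + v'(k)(A k − c) ], with the supremum attained uniquely at c = m k (the equilibrium policy σ_e(k) = m k); moreover K(t,k) := k e^{(A − m)t} satisfies ∂K/∂t = A K − σ_e(K) with K(0,k) = k, so g(k) = ∫_τ^∞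 e^{−δ₁ t} ln( σ_e(K(t,k)) ) dt. -/
open MeasureTheory

/-- `t * exp (-δ t)` is integrable on `(τ, ∞)` for `δ, τ > 0`. -/
theorem integrableOn_mul_exp_neg_mul_Ioi {δ τ : ℝ} (hδ : 0 < δ) (hτ : 0 < τ) :
    IntegrableOn (fun t : ℝ => t * Real.exp (-δ * t)) (Set.Ioi τ) := by
  have h := integrableOn_rpow_mul_exp_neg_mul_rpow (p := 1) (s := 1) (b := δ)
    (by norm_num) one_pos hδ
  simp only [Real.rpow_one] at h
  exact h.mono_set (Set.Ioi_subset_Ioi hτ.le)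

/-- Splitting off `log k` from a discounted integral of the logarithm along an exponential path. -/
theorem integral_exp_neg_mul_log_mul_exp {δ τ m k : ℝ} (hδ : 0 < δ) (hτ : 0 < τ) (hm : 0 < m)
    (hk : 0 < k) (r : ℝ) :
    ∫ t in Set.Ioi τ, Real.exp (-δ * t) * Real.log (m * k * Real.exp (r * t)) =
      (1 / δ) * Real.exp (-δ * τ) * Real.log k +
        ((1 / δ) * Real.exp (-δ * τ) * Real.log m +
          r * ∫ t in Set.Ioi τ, t * Real.exp (-δ * t)) := by
  have hpt : ∀ t : ℝ, Real.exp (-δ * t) * Real.log (m * k * Real.exp (r * t)) =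
      (Real.log m + Real.log k) * Real.exp (-δ * t) + r * (t * Real.exp (-δ * t)) := by
    intro t
    rw [Real.log_mul (by positivity) (Real.exp_ne_zero _), Real.log_mul hm.ne' hk.ne',
      Real.log_exp]
    ring
  simp_rw [hpt]
  rw [integral_add ((integrableOn_exp_mul_Ioi (neg_lt_zero.mpr hδ) τ).const_mul _)
    ((integrableOn_mul_exp_neg_mul_Ioi hδ hτ).const_mul _), integral_const_mul,
    integral_const_mul, integral_exp_mul_Ioi (neg_lt_zero.mpr hδ)]
  field_simp
  ring

/-- The strictly concave map `c ↦ log c - c / a` lies below its value at `a`, strictly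
off `a`. -/
theorem log_sub_div_lt {a c : ℝ} (ha : 0 < a) (hc : 0 < c) (hne : c ≠ a) :
    Real.log c - c / a < Real.log a - 1 := by
  have h := Real.log_lt_sub_one_of_pos (div_pos hc ha) (by rwa [ne_eq, div_eq_one_iff_eq ha.ne'])
  rw [Real.log_div hc.ne' ha.ne'] at h
  linarith

/-- Equilibrium-policy example with piecewise exponential discounting, logarithmic
utility and linear technology `f(k) = A k`. With `m = δ₀/(1 + ((δ₀−δ₁)/δ₁)e^{−δ₁τ})`
and the non-local term `g(k) = ∫_τ^∞ e^{−δ₁ t} ln(m k e^{(A−m)t}) dt`: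
`g(k) = (1/δ₁)e^{−δ₁τ} ln k + ς` for a constant `ς`; there is a constant `b` such that
`v(k) = (1/m) ln k + b` satisfies `δ₀ v(k) = sup_{c>0}[ln c + (δ₀−δ₁)g(k) + v'(k)(Ak−c)]`
with the supremum attained uniquely at `c = m k`; and `K(t,k) = k e^{(A−m)t}` is the
equilibrium flow, so `g(k) = ∫_τ^∞ e^{−δ₁ t} ln(σ_e(K(t,k))) dt` with `σ_e(k) = m k`. -/
theorem stmt_19 (δ₀ δ₁ τ A : ℝ) (h0 : 0 < δ₁) (h01 : δ₁ < δ₀) (hτ : 0 < τ) :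
    let m : ℝ := δ₀ / (1 + ((δ₀ - δ₁) / δ₁) * Real.exp (-δ₁ * τ))
    let g : ℝ → ℝ := fun k =>
      ∫ t in Set.Ioi τ, Real.exp (-δ₁ * t) * Real.log (m * k * Real.exp ((A - m) * t))
    let K : ℝ → ℝ → ℝ := fun t k => k * Real.exp ((A - m) * t)
    (∃ ς : ℝ, ∀ k > (0 : ℝ), g k = (1 / δ₁) * Real.exp (-δ₁ * τ) * Real.log k + ς) ∧
    (∃ b : ℝ, ∀ k > (0 : ℝ),
      IsGreatest
        ((fun c => Real.log c + (δ₀ - δ₁) * g k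
            + deriv (fun x => (1 / m) * Real.log x + b) k * (A * k - c)) '' Set.Ioi 0)
        (δ₀ * ((1 / m) * Real.log k + b)) ∧
      Real.log (m * k) + (δ₀ - δ₁) * g k
          + deriv (fun x => (1 / m) * Real.log x + b) k * (A * k - m * k)
        = δ₀ * ((1 / m) * Real.log k + b) ∧
      ∀ c > (0 : ℝ),
        Real.log c + (δ₀ - δ₁) * g k
            + deriv (fun x => (1 / m) * Real.log x + b) k * (A * k - c)
          = δ₀ * ((1 / m) * Real.log k + b) → c = m * k) ∧
    (∀ k : ℝ, K 0 k = k) ∧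
    (∀ k t : ℝ, HasDerivAt (fun s => K s k) (A * K t k - m * K t k) t) ∧
    (∀ k > (0 : ℝ), g k = ∫ t in Set.Ioi τ, Real.exp (-δ₁ * t) * Real.log (m * K t k)) := by
  intro m g K
  have hδ₀ : 0 < δ₀ := h0.trans h01
  have hD : 0 < 1 + ((δ₀ - δ₁) / δ₁) * Real.exp (-δ₁ * τ) := by
    have := sub_pos.mpr h01
    positivity
  have hm : 0 < m := div_pos hδ₀ hD
  have hδm : δ₀ * (1 / m) = 1 + (δ₀ - δ₁) * ((1 / δ₁) * Real.exp (-δ₁ * τ)) := by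
    have : δ₀ / m = 1 + ((δ₀ - δ₁) / δ₁) * Real.exp (-δ₁ * τ) := div_div_cancel₀ hδ₀.ne'
    rw [mul_one_div, this]
    ring
  have hg : ∃ ς : ℝ, ∀ k > (0 : ℝ),
      g k = (1 / δ₁) * Real.exp (-δ₁ * τ) * Real.log k + ς :=
    ⟨_, fun k hk => integral_exp_neg_mul_log_mul_exp h0 hτ hm hk (A - m)⟩
  refine ⟨hg, ?_, fun k => by simp [K], fun k t => ?_, fun k _ => ?_⟩
  · obtain ⟨ς, hς⟩ := hg
    refine ⟨(Real.log m + (δ₀ - δ₁) * ς + A / m - 1) / δ₀, fun k hk => ?_⟩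
    generalize hb : (Real.log m + (δ₀ - δ₁) * ς + A / m - 1) / δ₀ = b
    have hb' : δ₀ * b = Real.log m + (δ₀ - δ₁) * ς + A / m - 1 := by
      rw [← hb, mul_div_cancel₀ _ hδ₀.ne']
    have hmk : 0 < m * k := mul_pos hm hk
    have hderiv : deriv (fun x => (1 / m) * Real.log x + b) k = 1 / (m * k) := by
      rw [(((Real.hasDerivAt_log hk.ne').const_mul (1 / m)).add_const b).deriv]
      field_simp
    have hval : ∀ c : ℝ, Real.log c + (δ₀ - δ₁) * g k + 1 / (m * k) * (A * k - c) =
        δ₀ * ((1 / m) * Real.log k + b) +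
          ((Real.log c - c / (m * k)) - (Real.log (m * k) - 1)) := by
      intro c
      have hA : 1 / (m * k) * (A * k - c) = A / m - c / (m * k) := by field_simp
      rw [mul_add, ← mul_assoc, hδm, hb', hς k hk, hA, Real.log_mul hm.ne' hk.ne']
      ring
    have hmax : Real.log (m * k) + (δ₀ - δ₁) * g k + 1 / (m * k) * (A * k - m * k) =
        δ₀ * ((1 / m) * Real.log k + b) := by
      rw [hval, div_self hmk.ne']
      ring
    have huniq : ∀ c > (0 : ℝ), c ≠ m * k →
        Real.log c + (δ₀ - δ₁) * g k + 1 / (m * k) * (A * k - c) <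
          δ₀ * ((1 / m) * Real.log k + b) := by
      intro c hc hne
      rw [hval]
      linarith [log_sub_div_lt hmk hc hne]
    rw [hderiv]
    refine ⟨⟨⟨m * k, hmk, hmax⟩, ?_⟩, hmax, fun c hc h => ?_⟩
    · rintro _ ⟨c, hc, rfl⟩
      rcases eq_or_ne c (m * k) with rfl | hne
      · exact hmax.le
      · exact (huniq c hc hne).le
    · by_contra hne
      exact (huniq c hc hne).ne h
  · have h := (((hasDerivAt_id t).const_mul (A - m)).exp).const_mul k
    refine h.congr_deriv ?_
    simp only [K, id]
    ring
  · simp only [g, K, mul_assoc]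
end
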